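/- arXiv:1608.08712 — 10 statements merged into one kernel-verified Lean document; each statement's English description precedes it below -/
import Mathlib

section
/- For all real numbers n > 0, t > 0 and all x, y ∈ ℝ, √(n/(2πt)) · Σ_{k∈ℤ} [exp(−n(y − x + 2kπ)²/(2t)) + exp(−n(y + x + 2kπ)²/(2t))] = 1/π + (2/π) Σ_{k=1}^∞ cos(kx) · exp(−t k²/(2n)) · cos(ky), both series converging absolutely. -/
open HurwitzZeta in
/-- The Gaussian sum over the lattice `2πℤ` translated by `z`, written with `evenKernel`. -/
theorem hasSum_int_gaussian_evenKernel {n t : ℝ} (hn : 0 < n) (ht : 0 < t) (z : ℝ) :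
    HasSum (fun k : ℤ => Real.exp (-n * (z + 2 * k * Real.pi) ^ 2 / (2 * t)))
      (evenKernel ((z / (2 * Real.pi) : ℝ) : UnitAddCircle) (2 * Real.pi * n / t)) := by
  have hpi := Real.pi_pos
  refine (hasSum_int_evenKernel (z / (2 * Real.pi)) (t := 2 * Real.pi * n / t)
    (by positivity)).congr_fun fun k => ?_
  congr 1
  field_simp
  ring

open HurwitzZeta in
/-- The heat-kernel cosine series, written with `cosKernel`. -/
theorem hasSum_nat_cos_cosKernel {n t : ℝ} (hn : 0 < n) (ht : 0 < t) (z : ℝ) :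
    HasSum (fun k : ℕ => 2 * Real.cos ((k + 1) * z) * Real.exp (-t * (k + 1) ^ 2 / (2 * n)))
      (cosKernel ((z / (2 * Real.pi) : ℝ) : UnitAddCircle) (1 / (2 * Real.pi * n / t)) - 1) := by
  have hpi := Real.pi_pos
  refine (hasSum_nat_cosKernel₀ (z / (2 * Real.pi)) (t := 1 / (2 * Real.pi * n / t))
    (by positivity)).congr_fun fun k => ?_
  congr 3
  · field_simp
  · field_simp

open HurwitzZeta in
theorem sqrt_mul_evenKernel_eq_cosKernel {n t : ℝ} (hn : 0 < n) (ht : 0 < t) (a : UnitAddCircle) :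
    Real.sqrt (n / (2 * Real.pi * t)) * evenKernel a (2 * Real.pi * n / t) =
      1 / (2 * Real.pi) * cosKernel a (1 / (2 * Real.pi * n / t)) := by
  have hpi := Real.pi_pos
  have hs : Real.sqrt (n / (2 * Real.pi * t)) =
      1 / (2 * Real.pi) * Real.sqrt (2 * Real.pi * n / t) := by
    rw [Real.sqrt_eq_iff_mul_self_eq (by positivity) (by positivity), mul_mul_mul_comm,
      Real.mul_self_sqrt (by positivity)]
    field_simp
  have h0 : Real.sqrt (2 * Real.pi * n / t) ≠ 0 := (Real.sqrt_pos.2 (by positivity)).ne'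
  rw [evenKernel_functional_equation, ← Real.sqrt_eq_rpow, hs]
  field_simp

/-- Poisson summation (Jacobi theta transformation) identity for the reflecting heat
kernel on `[0, π]`: the sum over all integers of Gaussian terms equals a cosine series. -/
theorem reflecting_heat_kernel_cosine_series (n t : ℝ) (hn : 0 < n) (ht : 0 < t) (x y : ℝ) :
    Summable (fun k : ℤ =>
      |Real.exp (-n * (y - x + 2 * k * Real.pi) ^ 2 / (2 * t)) +
        Real.exp (-n * (y + x + 2 * k * Real.pi) ^ 2 / (2 * t))|) ∧
    Summable (fun k : ℕ =>
      |Real.cos ((k + 1) * x) * Real.exp (-t * (k + 1) ^ 2 / (2 * n)) * Real.cos ((k + 1) * y)|) ∧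
    Real.sqrt (n / (2 * Real.pi * t)) *
      ∑' k : ℤ, (Real.exp (-n * (y - x + 2 * k * Real.pi) ^ 2 / (2 * t)) +
        Real.exp (-n * (y + x + 2 * k * Real.pi) ^ 2 / (2 * t)))
    = 1 / Real.pi + (2 / Real.pi) *
      ∑' k : ℕ, Real.cos ((k + 1) * x) * Real.exp (-t * (k + 1) ^ 2 / (2 * n)) *
        Real.cos ((k + 1) * y) := by
  have hE := (hasSum_int_gaussian_evenKernel hn ht (y - x)).add
    (hasSum_int_gaussian_evenKernel hn ht (y + x))
  have hC := (((hasSum_nat_cos_cosKernel hn ht (y - x)).add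
    (hasSum_nat_cos_cosKernel hn ht (y + x))).mul_left (1 / 4)).congr_fun
    (g := fun k : ℕ => Real.cos ((k + 1) * x) * Real.exp (-t * (k + 1) ^ 2 / (2 * n)) *
      Real.cos ((k + 1) * y)) fun k => by
        rw [mul_sub, mul_add _ y, Real.cos_sub, Real.cos_add]
        ring
  refine ⟨hE.summable.abs, hC.summable.abs, ?_⟩
  rw [hE.tsum_eq, hC.tsum_eq, mul_add, sqrt_mul_evenKernel_eq_cosKernel hn ht,
    sqrt_mul_evenKernel_eq_cosKernel hn ht]
  field_simp
  ring
end

section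
/- For all real numbers n > 0, t > 0 and all x, y ∈ ℝ, √(n/(2πt)) · Σ_{k∈ℤ} [exp(−n(y − x + 2kπ)²/(2t)) − exp(−n(y + x + 2kπ)²/(2t))] = (2/π) Σ_{k=1}^∞ sin(kx) · exp(−t k²/(2n)) · sin(ky), both series converging absolutely. -/
open HurwitzZeta in
/-- The periodized Gaussian on `ℝ / 2πℤ` sums to a value of the even Hurwitz kernel. -/
lemma hasSum_periodized_gaussian {n t : ℝ} (hn : 0 < n) (ht : 0 < t) (z : ℝ) :
    HasSum (fun k : ℤ => Real.exp (-n * (z + 2 * k * Real.pi) ^ 2 / (2 * t)))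
      (evenKernel (z / (2 * Real.pi) : ℝ) (2 * Real.pi * n / t)) := by
  have hs : 0 < 2 * Real.pi * n / t := by positivity
  refine (hasSum_int_evenKernel (z / (2 * Real.pi)) hs).congr_fun fun k => ?_
  congr 1
  field_simp
  ring

open HurwitzZeta in
/-- The cosine series of the heat kernel on `ℝ / 2πℤ`, without its constant term. -/
lemma hasSum_heat_cosine_series {n t : ℝ} (hn : 0 < n) (ht : 0 < t) (z : ℝ) :
    HasSum (fun k : ℕ => 2 * Real.cos ((k + 1) * z) * Real.exp (-t * (k + 1) ^ 2 / (2 * n)))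
      (cosKernel (z / (2 * Real.pi) : ℝ) (1 / (2 * Real.pi * n / t)) - 1) := by
  have hs : 0 < 1 / (2 * Real.pi * n / t) := by positivity
  refine (hasSum_nat_cosKernel₀ (z / (2 * Real.pi)) hs).congr_fun fun k => ?_
  congr 2
  · congr 1
    field_simp
  · field_simp

/-- Poisson summation (Jacobi theta transformation) identity for the absorbing heat
kernel on `[0, π]`: the sum over all integers of Gaussian terms equals a sine series. -/
theorem absorbing_heat_kernel_sine_series (n t : ℝ) (hn : 0 < n) (ht : 0 < t) (x y : ℝ) :
    Summable (fun k : ℤ =>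
      |Real.exp (-n * (y - x + 2 * k * Real.pi) ^ 2 / (2 * t)) -
        Real.exp (-n * (y + x + 2 * k * Real.pi) ^ 2 / (2 * t))|) ∧
    Summable (fun k : ℕ =>
      |Real.sin ((k + 1) * x) * Real.exp (-t * (k + 1) ^ 2 / (2 * n)) * Real.sin ((k + 1) * y)|) ∧
    Real.sqrt (n / (2 * Real.pi * t)) *
      ∑' k : ℤ, (Real.exp (-n * (y - x + 2 * k * Real.pi) ^ 2 / (2 * t)) -
        Real.exp (-n * (y + x + 2 * k * Real.pi) ^ 2 / (2 * t)))
    = (2 / Real.pi) *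
      ∑' k : ℕ, Real.sin ((k + 1) * x) * Real.exp (-t * (k + 1) ^ 2 / (2 * n)) *
        Real.sin ((k + 1) * y) := by
  have hG := (hasSum_periodized_gaussian hn ht (y - x)).sub
    (hasSum_periodized_gaussian hn ht (y + x))
  have hS := (((hasSum_heat_cosine_series hn ht (y - x)).sub
    (hasSum_heat_cosine_series hn ht (y + x))).mul_left (1 / 4)).congr_fun
    (g := fun k : ℕ => Real.sin ((k + 1) * x) * Real.exp (-t * (k + 1) ^ 2 / (2 * n)) *
        Real.sin ((k + 1) * y)) fun k => by
      rw [mul_sub ((k : ℝ) + 1), mul_add ((k : ℝ) + 1), Real.cos_sub, Real.cos_add]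
      ring
  refine ⟨hG.summable.abs, hS.summable.abs, ?_⟩
  have hsqrt : Real.sqrt (n / (2 * Real.pi * t)) * (1 / (2 * Real.pi * n / t) ^ (1 / 2 : ℝ)) =
      1 / (2 * Real.pi) := by
    rw [← Real.sqrt_eq_rpow, mul_one_div, ← Real.sqrt_div (by positivity),
      show n / (2 * Real.pi * t) / (2 * Real.pi * n / t) = (1 / (2 * Real.pi)) ^ 2 by field_simp,
      Real.sqrt_sq (by positivity)]
  rw [hG.tsum_eq, hS.tsum_eq, HurwitzZeta.evenKernel_functional_equation,
    HurwitzZeta.evenKernel_functional_equation, ← mul_sub, ← mul_assoc, hsqrt]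
  field_simp
  ring
end

section
/- Fix n ∈ ℕ+, T > 0, k ∈ ℕ and a > 0, and assume the degree-k discrete Gaussian orthogonal polynomials p^T_{n,k} (for (n, T)) and p^{2T}_{2n,k} (for (2n, 2T)) exist. Then for all x ∈ ℝ: S_{k,a}(−x; n, T) = (−1)^k · S_{k,a}(x; n, T), and S_{k,a}(x; n, T) = 2^{k+1} · S_{k,2a}(x; 2n, 2T). -/
/-- The discrete Gaussian weight `w_{n,T}(s) = exp(-nTs²/2)`. -/
noncomputable def dgWeight (n : ℕ+) (T : ℝ) (s : ℝ) : ℝ :=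
  Real.exp (-((n : ℕ) : ℝ) * T * s ^ 2 / 2)

/-- `p` is the degree-`k` discrete Gaussian orthogonal polynomial for `(n, T)`:
it is monic of degree `k` and orthogonal to all lower powers on the lattice of
mesh `1/n` with weight `w_{n,T}`, all sums converging absolutely. -/
def IsDGOP (n : ℕ+) (T : ℝ) (k : ℕ) (p : Polynomial ℝ) : Prop :=
  p.Monic ∧ p.natDegree = k ∧
  ∀ j < k,
    Summable (fun m : ℤ => p.eval ((m : ℝ) / ((n : ℕ) : ℝ)) * ((m : ℝ) / ((n : ℕ) : ℝ)) ^ j *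
      dgWeight n T ((m : ℝ) / ((n : ℕ) : ℝ))) ∧
    (∑' m : ℤ, p.eval ((m : ℝ) / ((n : ℕ) : ℝ)) * ((m : ℝ) / ((n : ℕ) : ℝ)) ^ j *
      dgWeight n T ((m : ℝ) / ((n : ℕ) : ℝ))) = 0

/-- The discrete Fourier transform `S_{k,a}(x; n, T)` of the polynomial `p` (meant to be
the degree-`k` discrete Gaussian orthogonal polynomial for `(n, T)`). -/
noncomputable def Sdft (n : ℕ+) (a : ℝ) (p : Polynomial ℝ) (x : ℝ) : ℂ :=
  (1 / ((n : ℕ) : ℝ) : ℝ) * ∑' m : ℤ, (↑(p.eval ((m : ℝ) / ((n : ℕ) : ℝ))) : ℂ) *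
    Complex.exp (-(((n : ℕ) : ℝ) : ℂ) * (a : ℂ) * (((m : ℝ) / ((n : ℕ) : ℝ) : ℝ) : ℂ) ^ 2 / 2) *
    Complex.exp (Complex.I * (((n : ℕ) : ℝ) : ℂ) * (((m : ℝ) / ((n : ℕ) : ℝ) : ℝ) : ℂ) * (x : ℂ))

theorem IsDGOP.hasSum {n : ℕ+} {T : ℝ} {k : ℕ} {p : Polynomial ℝ} (hp : IsDGOP n T k p)
    {j : ℕ} (hj : j < k) :
    HasSum (fun m : ℤ => p.eval ((m : ℝ) / ((n : ℕ) : ℝ)) * ((m : ℝ) / ((n : ℕ) : ℝ)) ^ j *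
      dgWeight n T ((m : ℝ) / ((n : ℕ) : ℝ))) 0 := by
  have h := hp.2.2 j hj
  exact h.2 ▸ h.1.hasSum

/-- A polynomial vanishing on the lattice of mesh `1/n` is zero. -/
theorem eq_zero_of_eval_lattice_eq_zero (n : ℕ+) (d : Polynomial ℝ)
    (h : ∀ m : ℤ, d.eval ((m : ℝ) / ((n : ℕ) : ℝ)) = 0) : d = 0 := by
  have hn : ((n : ℕ) : ℝ) ≠ 0 := Nat.cast_ne_zero.mpr n.ne_zero
  refine Polynomial.eq_zero_of_infinite_isRoot d
    ((Set.infinite_range_of_injective (f := fun m : ℤ => (m : ℝ) / ((n : ℕ) : ℝ)) ?_).mono ?_)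
  · intro x y hxy
    exact_mod_cast (div_left_inj' hn).mp hxy
  · rintro _ ⟨m, rfl⟩
    exact h m

theorem IsDGOP.unique {n : ℕ+} {T : ℝ} {k : ℕ} {p q : Polynomial ℝ}
    (hp : IsDGOP n T k p) (hq : IsDGOP n T k q) : p = q := by
  rw [← sub_eq_zero]
  rcases Nat.eq_zero_or_pos k with rfl | hk
  · rw [hp.1.natDegree_eq_zero.mp hp.2.1, hq.1.natDegree_eq_zero.mp hq.2.1, sub_self]
  set d := p - q with hd
  have hdeg : d.natDegree < k := by
    by_cases hd0 : d = 0
    · simpa [hd0] using hk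
    · rw [Polynomial.natDegree_lt_iff_degree_lt hd0]
      have hpd : p.degree = k := by
        rw [Polynomial.degree_eq_natDegree hp.1.ne_zero, hp.2.1]
      have hqd : q.degree = k := by
        rw [Polynomial.degree_eq_natDegree hq.1.ne_zero, hq.2.1]
      rw [← hpd]
      exact Polynomial.degree_sub_lt_left (hpd.trans hqd.symm) hp.1.ne_zero
        (hp.1.leadingCoeff.trans hq.1.leadingCoeff.symm)
  have hsum : HasSum (fun m : ℤ => d.eval ((m : ℝ) / ((n : ℕ) : ℝ)) ^ 2 *
      dgWeight n T ((m : ℝ) / ((n : ℕ) : ℝ))) 0 := by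
    have h := hasSum_sum (s := Finset.range k) fun j hj =>
      (((hp.hasSum (Finset.mem_range.mp hj)).sub
        (hq.hasSum (Finset.mem_range.mp hj))).mul_left (d.coeff j))
    simp only [sub_zero, mul_zero, Finset.sum_const_zero] at h
    refine h.congr_fun ?_
    intro m
    rw [sq]
    nth_rewrite 2 [Polynomial.eval_eq_sum_range' hdeg]
    rw [Finset.mul_sum, Finset.sum_mul]
    refine Finset.sum_congr rfl fun j _ => ?_
    rw [hd, Polynomial.eval_sub]
    ring
  have hw : ∀ s, 0 < dgWeight n T s := fun s => Real.exp_pos _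
  have hzero := (hasSum_zero_iff_of_nonneg
    (fun m : ℤ => mul_nonneg (sq_nonneg (d.eval ((m : ℝ) / ((n : ℕ) : ℝ)))) (hw _).le)).mp hsum
  refine eq_zero_of_eval_lattice_eq_zero n d fun m => ?_
  simpa [(hw _).ne'] using congr_fun hzero m

theorem IsDGOP.scaleRoots_neg_one {n : ℕ+} {T : ℝ} {k : ℕ} {p : Polynomial ℝ}
    (hp : IsDGOP n T k p) : IsDGOP n T k (p.scaleRoots (-1)) := by
  refine ⟨(Polynomial.monic_scaleRoots_iff _).mpr hp.1,
    (Polynomial.natDegree_scaleRoots _ _).trans hp.2.1, fun j hj => ?_⟩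
  have h := (((Equiv.neg ℤ).hasSum_iff).mpr (hp.hasSum hj)).mul_left ((-1) ^ k * (-1) ^ j)
  rw [mul_zero] at h
  refine (fun hs => ⟨hs.summable, hs.tsum_eq⟩) (h.congr_fun fun m => ?_)
  have he := p.scaleRoots_eval_mul (-((m : ℝ) / ((n : ℕ) : ℝ))) (-1)
  rw [neg_mul_neg, one_mul, hp.2.1] at he
  simp only [Function.comp_apply, Equiv.neg_apply, Int.cast_neg, neg_div, he, dgWeight, neg_sq]
  rw [neg_pow (_ / _) j]
  have : ((-1 : ℝ) ^ j) * (-1) ^ j = 1 := by rw [← mul_pow]; simp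
  linear_combination (-(-1) ^ k * p.eval (-((m : ℝ) / ((n : ℕ) : ℝ))) *
    ((m : ℝ) / ((n : ℕ) : ℝ)) ^ j * Real.exp (-((n : ℕ) : ℝ) * T *
    ((m : ℝ) / ((n : ℕ) : ℝ)) ^ 2 / 2)) * this

/-- Parity of the discrete Gaussian orthogonal polynomials. -/
theorem IsDGOP.eval_neg {n : ℕ+} {T : ℝ} {k : ℕ} {p : Polynomial ℝ}
    (hp : IsDGOP n T k p) (s : ℝ) : p.eval (-s) = (-1) ^ k * p.eval s := by
  have h := p.scaleRoots_eval_mul s (-1)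
  rwa [hp.scaleRoots_neg_one.unique hp, hp.2.1, neg_one_mul] at h

theorem lattice_div_eq (n : ℕ+) (m : ℤ) :
    (m : ℝ) / ((n : ℕ) : ℝ) = 2 * ((m : ℝ) / (((2 * n : ℕ+) : ℕ) : ℝ)) := by
  push_cast
  field_simp

theorem IsDGOP.scaleRoots_two {n : ℕ+} {T : ℝ} {k : ℕ} {q : Polynomial ℝ}
    (hq : IsDGOP (2 * n) (2 * T) k q) : IsDGOP n T k (q.scaleRoots 2) := by
  refine ⟨(Polynomial.monic_scaleRoots_iff _).mpr hq.1,
    (Polynomial.natDegree_scaleRoots _ _).trans hq.2.1, fun j hj => ?_⟩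
  have h := (hq.hasSum hj).mul_left (2 ^ k * 2 ^ j)
  rw [mul_zero] at h
  refine (fun hs => ⟨hs.summable, hs.tsum_eq⟩) (h.congr_fun fun m => ?_)
  have hw (s : ℝ) : dgWeight n T (2 * s) = dgWeight (2 * n) (2 * T) s := by
    unfold dgWeight
    push_cast
    ring_nf
  rw [lattice_div_eq, hw, q.scaleRoots_eval_mul, hq.2.1, mul_pow]
  ring

theorem Sdft_parity_and_rescaling (n : ℕ+) (T : ℝ) (hT : 0 < T) (k : ℕ) (a : ℝ) (ha : 0 < a)
    (p q : Polynomial ℝ) (hp : IsDGOP n T k p) (hq : IsDGOP (2 * n) (2 * T) k q) :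
    (∀ x : ℝ, Sdft n a p (-x) = (-1) ^ k * Sdft n a p x) ∧
    (∀ x : ℝ, Sdft n a p x = 2 ^ (k + 1) * Sdft (2 * n) (2 * a) q x) := by
  constructor
  · intro x
    unfold Sdft
    rw [← tsum_mul_left, ← tsum_mul_left, ← tsum_mul_left, ← (Equiv.neg ℤ).tsum_eq]
    refine tsum_congr fun m => ?_
    simp only [Equiv.neg_apply, Int.cast_neg, neg_div, hp.eval_neg]
    push_cast
    ring_nf
  · intro x
    obtain rfl := hp.unique hq.scaleRoots_two
    unfold Sdft
    rw [← tsum_mul_left, ← tsum_mul_left, ← tsum_mul_left]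
    refine tsum_congr fun m => ?_
    rw [lattice_div_eq, q.scaleRoots_eval_mul, hq.2.1]
    push_cast
    ring_nf
end

section
/- Fix n ∈ ℕ+ and T > 0, and assume that for every k < 2n the degree-k discrete Gaussian orthogonal polynomials for (n, T) and for (2n, 2T) exist. Then for all 0 < t₁ < T, 0 < t₂ < T and all x, y ∈ ℝ: K̃^abs_{t₁,t₂}(x, y; n, T) = K̃_{2t₁,2t₂}(x, y; 2n, 2T) − K̃_{2t₁,2t₂}(x, −y; 2n, 2T). -/
/-- The squared norm `h^T_{n,k}` of a discrete Gaussian orthogonal polynomial. -/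
noncomputable def dgNorm (n : ℕ+) (T : ℝ) (p : Polynomial ℝ) : ℝ :=
  (1 / ((n : ℕ) : ℝ)) * ∑' m : ℤ, (p.eval ((m : ℝ) / ((n : ℕ) : ℝ))) ^ 2 *
    dgWeight n T ((m : ℝ) / ((n : ℕ) : ℝ))

/-- The circle kernel `K̃_{t₁,t₂}(x, y; m, S)`, where `P k` is the degree-`k`
discrete Gaussian orthogonal polynomial for `(m, S)`. -/
noncomputable def Kcirc (m : ℕ+) (S : ℝ) (P : ℕ → Polynomial ℝ) (t₁ t₂ x y : ℝ) : ℂ :=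
  ((((m : ℕ) : ℝ) / (2 * Real.pi) : ℝ) : ℂ) * ∑ k ∈ Finset.range (m : ℕ),
    ((dgNorm m S (P k) : ℝ) : ℂ)⁻¹ * Sdft m (S - t₁) (P k) x * Sdft m t₂ (P k) (-y)

/-- The absorbing-wall kernel `K̃^abs_{t₁,t₂}(x, y; n, T)`, where `P k` is the degree-`k`
discrete Gaussian orthogonal polynomial for `(n, T)`. -/
noncomputable def Kabs (n : ℕ+) (T : ℝ) (P : ℕ → Polynomial ℝ) (t₁ t₂ x y : ℝ) : ℂ :=
  ((((n : ℕ) : ℝ) / Real.pi : ℝ) : ℂ) * ∑ k ∈ Finset.range (n : ℕ),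
    ((dgNorm n T (P (2 * k + 1)) : ℝ) : ℂ)⁻¹ * Sdft n (T - t₁) (P (2 * k + 1)) x *
      Sdft n t₂ (P (2 * k + 1)) (-y)

theorem eval_scaleRoots_mul (r : Polynomial ℝ) (c x : ℝ) :
    (r.scaleRoots c).eval (c * x) = c ^ r.natDegree * r.eval x := by
  simpa [Polynomial.eval₂_id] using
    Polynomial.scaleRoots_eval₂_mul (p := r) (f := RingHom.id ℝ) (r := x) (s := c)

theorem dgWeight_pos (n : ℕ+) (T s : ℝ) : 0 < dgWeight n T s := Real.exp_pos _

theorem dgWeight_neg (n : ℕ+) (T s : ℝ) : dgWeight n T (-s) = dgWeight n T s := by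
  simp [dgWeight]

theorem dgWeight_two_mul (n : ℕ+) (T s : ℝ) :
    dgWeight (2 * n) (2 * T) (1 / 2 * s) = dgWeight n T s := by
  unfold dgWeight
  push_cast
  congr 1
  ring

theorem lattice_two_mul (n : ℕ+) (m : ℤ) :
    (m : ℝ) / ((2 * n : ℕ+) : ℕ) = 1 / 2 * ((m : ℝ) / (n : ℕ)) := by
  push_cast
  field_simp

namespace IsDGOP

variable {n : ℕ+} {T : ℝ} {k : ℕ} {r r' : Polynomial ℝ}

/-- A discrete Gaussian orthogonal polynomial is orthogonal to all polynomials of lower degree. -/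
theorem hasSum_mul (h : IsDGOP n T k r) {d : Polynomial ℝ} (hd : d.natDegree < k) :
    HasSum (fun m : ℤ => r.eval ((m : ℝ) / (n : ℕ)) * d.eval ((m : ℝ) / (n : ℕ)) *
      dgWeight n T ((m : ℝ) / (n : ℕ))) 0 := by
  have key := hasSum_sum (s := Finset.range k) fun j hj =>
    ((h.2.2 j (Finset.mem_range.mp hj)).1.hasSum).mul_left (d.coeff j)
  have hzero : ∑ j ∈ Finset.range k, d.coeff j * ∑' m : ℤ, r.eval ((m : ℝ) / (n : ℕ)) *
      ((m : ℝ) / (n : ℕ)) ^ j * dgWeight n T ((m : ℝ) / (n : ℕ)) = 0 :=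
    Finset.sum_eq_zero fun j hj => by
      rw [(h.2.2 j (Finset.mem_range.mp hj)).2, mul_zero]
  rw [hzero] at key
  refine key.congr_fun fun m => ?_
  rw [Polynomial.eval_eq_sum_range' hd, Finset.mul_sum, Finset.sum_mul]
  exact Finset.sum_congr rfl fun j _ => by ring

theorem unique_s8 (h : IsDGOP n T k r) (h' : IsDGOP n T k r') : r = r' := by
  by_contra hne
  have hd0 : r - r' ≠ 0 := sub_ne_zero.mpr hne
  have hlt : (r - r').natDegree < k := by
    rw [Polynomial.natDegree_lt_iff_degree_lt hd0]
    have hdeg : r.degree = k := by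
      rw [Polynomial.degree_eq_natDegree h.1.ne_zero, h.2.1]
    have hdeg' : r'.degree = k := by
      rw [Polynomial.degree_eq_natDegree h'.1.ne_zero, h'.2.1]
    rw [← hdeg]
    exact Polynomial.degree_sub_lt_left (hdeg.trans hdeg'.symm) h.1.ne_zero
      (h.1.leadingCoeff.trans h'.1.leadingCoeff.symm)
  have hsum := (h.hasSum_mul hlt).sub (h'.hasSum_mul hlt)
  rw [sub_zero] at hsum
  have hnonneg : ∀ m : ℤ, 0 ≤ (r.eval ((m : ℝ) / (n : ℕ)) * (r - r').eval ((m : ℝ) / (n : ℕ)) *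
      dgWeight n T ((m : ℝ) / (n : ℕ)) - r'.eval ((m : ℝ) / (n : ℕ)) *
      (r - r').eval ((m : ℝ) / (n : ℕ)) * dgWeight n T ((m : ℝ) / (n : ℕ))) := fun m => by
    rw [← sub_mul, ← sub_mul, ← Polynomial.eval_sub]
    exact mul_nonneg (mul_self_nonneg _) (dgWeight_pos _ _ _).le
  have hzero := (hasSum_zero_iff_of_nonneg hnonneg).mp hsum
  refine hd0 (Polynomial.eq_zero_of_infinite_isRoot _ ?_)
  have hinj : Function.Injective fun m : ℤ => (m : ℝ) / (n : ℕ) := fun a b hab => by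
    have hn : ((n : ℕ) : ℝ) ≠ 0 := by simp
    simpa [div_left_inj' hn] using hab
  refine (Set.infinite_range_of_injective hinj).mono ?_
  rintro _ ⟨m, rfl⟩
  have hm := congrFun hzero m
  simp only [Pi.zero_apply] at hm
  rw [← sub_mul, ← sub_mul, ← Polynomial.eval_sub] at hm
  simpa [(dgWeight_pos n T _).ne'] using hm

theorem scaleRoots_neg_one_s8 (h : IsDGOP n T k r) : IsDGOP n T k (r.scaleRoots (-1)) := by
  refine ⟨(Polynomial.monic_scaleRoots_iff _).mpr h.1,
    (Polynomial.natDegree_scaleRoots _ _).trans h.2.1, fun j hj => ?_⟩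
  have hsum := ((h.2.2 j hj).1.hasSum.mul_left ((-1) ^ k * (-1) ^ j))
  rw [(h.2.2 j hj).2, mul_zero, ← (Equiv.neg ℤ).hasSum_iff] at hsum
  have hsum' : HasSum (fun m : ℤ => (r.scaleRoots (-1)).eval ((m : ℝ) / (n : ℕ)) *
      ((m : ℝ) / (n : ℕ)) ^ j * dgWeight n T ((m : ℝ) / (n : ℕ))) 0 := by
    refine hsum.congr_fun fun m => ?_
    have he := eval_scaleRoots_mul r (-1) (-((m : ℝ) / (n : ℕ)))
    rw [neg_mul_neg, one_mul, h.2.1] at he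
    simp only [Function.comp_apply, Equiv.neg_apply, Int.cast_neg, neg_div, dgWeight_neg]
    rw [he, neg_pow ((m : ℝ) / (n : ℕ)) j]
    have hone : ((-1 : ℝ) ^ j) * (-1) ^ j = 1 := by rw [← mul_pow]; simp
    linear_combination (-(-1) ^ k * r.eval (-((m : ℝ) / (n : ℕ))) * ((m : ℝ) / (n : ℕ)) ^ j *
      dgWeight n T ((m : ℝ) / (n : ℕ))) * hone
  exact ⟨hsum'.summable, hsum'.tsum_eq⟩

theorem scaleRoots_half (h : IsDGOP n T k r) :
    IsDGOP (2 * n) (2 * T) k (r.scaleRoots (1 / 2)) := by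
  refine ⟨(Polynomial.monic_scaleRoots_iff _).mpr h.1,
    (Polynomial.natDegree_scaleRoots _ _).trans h.2.1, fun j hj => ?_⟩
  have hsum := ((h.2.2 j hj).1.hasSum.mul_left ((1 / 2) ^ k * (1 / 2) ^ j))
  rw [(h.2.2 j hj).2, mul_zero] at hsum
  have hsum' : HasSum (fun m : ℤ =>
      (r.scaleRoots (1 / 2)).eval ((m : ℝ) / ((2 * n : ℕ+) : ℕ)) *
      ((m : ℝ) / ((2 * n : ℕ+) : ℕ)) ^ j *
      dgWeight (2 * n) (2 * T) ((m : ℝ) / ((2 * n : ℕ+) : ℕ))) 0 := by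
    refine hsum.congr_fun fun m => ?_
    rw [lattice_two_mul, eval_scaleRoots_mul, dgWeight_two_mul, h.2.1, mul_pow]
    ring
  exact ⟨hsum'.summable, hsum'.tsum_eq⟩

theorem eval_neg_s8 (h : IsDGOP n T k r) (s : ℝ) : r.eval (-s) = (-1) ^ k * r.eval s := by
  have he := eval_scaleRoots_mul r (-1) s
  rwa [← h.unique_s8 h.scaleRoots_neg_one_s8, h.2.1, neg_one_mul] at he

theorem Sdft_neg (h : IsDGOP n T k r) (a x : ℝ) :
    Sdft n a r (-x) = (-1) ^ k * Sdft n a r x := by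
  unfold Sdft
  rw [mul_left_comm]
  congr 1
  rw [← tsum_mul_left, ← (Equiv.neg ℤ).tsum_eq]
  congr 1
  funext m
  simp only [Equiv.neg_apply, Int.cast_neg, neg_div, h.eval_neg_s8]
  push_cast
  simp only [neg_sq, mul_neg, neg_mul, neg_neg]
  ring

end IsDGOP

theorem dgNorm_scaleRoots_half (n : ℕ+) (T : ℝ) (r : Polynomial ℝ) :
    dgNorm (2 * n) (2 * T) (r.scaleRoots (1 / 2)) =
      1 / 2 * ((1 / 2) ^ r.natDegree) ^ 2 * dgNorm n T r := by
  unfold dgNorm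
  simp only [lattice_two_mul, eval_scaleRoots_mul, dgWeight_two_mul, mul_pow, mul_assoc,
    tsum_mul_left]
  push_cast
  field_simp

theorem Sdft_scaleRoots_half (n : ℕ+) (a x : ℝ) (r : Polynomial ℝ) :
    Sdft (2 * n) (2 * a) (r.scaleRoots (1 / 2)) x =
      1 / 2 * (1 / 2) ^ r.natDegree * Sdft n a r x := by
  have hterm : ∀ m : ℤ,
      (((r.scaleRoots (1 / 2)).eval ((m : ℝ) / ((2 * n : ℕ+) : ℕ)) : ℝ) : ℂ) *
        Complex.exp (-((((2 * n : ℕ+) : ℕ) : ℝ) : ℂ) * ((2 * a : ℝ) : ℂ) *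
          (((m : ℝ) / ((2 * n : ℕ+) : ℕ) : ℝ) : ℂ) ^ 2 / 2) *
        Complex.exp (Complex.I * ((((2 * n : ℕ+) : ℕ) : ℝ) : ℂ) *
          (((m : ℝ) / ((2 * n : ℕ+) : ℕ) : ℝ) : ℂ) * (x : ℂ)) =
      (1 / 2) ^ r.natDegree * (((r.eval ((m : ℝ) / (n : ℕ)) : ℝ) : ℂ) *
        Complex.exp (-(((n : ℕ) : ℝ) : ℂ) * (a : ℂ) * (((m : ℝ) / (n : ℕ) : ℝ) : ℂ) ^ 2 / 2) *
        Complex.exp (Complex.I * (((n : ℕ) : ℝ) : ℂ) * (((m : ℝ) / (n : ℕ) : ℝ) : ℂ) *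
          (x : ℂ))) := fun m => by
    rw [lattice_two_mul, eval_scaleRoots_mul, ← mul_assoc, ← mul_assoc]
    congr 1
    · congr 1
      · push_cast
        ring
      · congr 1
        push_cast
        ring
    · congr 1
      push_cast
      ring
  unfold Sdft
  simp only [hterm, tsum_mul_left]
  rw [← mul_assoc, ← mul_assoc]
  congr 1
  push_cast
  field_simp

theorem sum_range_two_mul_of_even_eq_zero {M : Type*} [AddCommMonoid M] (f : ℕ → M) (N : ℕ)
    (hf : ∀ k, f (2 * k) = 0) :
    ∑ k ∈ Finset.range (2 * N), f k = ∑ k ∈ Finset.range N, f (2 * k + 1) := by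
  induction N with
  | zero => simp
  | succ N ih =>
    rw [mul_add, mul_one, Finset.sum_range_succ, Finset.sum_range_succ, Finset.sum_range_succ, ih,
      hf, add_zero]

theorem absorbing_kernel_odd_part (n : ℕ+) (T : ℝ) (hT : 0 < T)
    (p q : ℕ → Polynomial ℝ)
    (hp : ∀ k < 2 * (n : ℕ), IsDGOP n T k (p k))
    (hq : ∀ k < 2 * (n : ℕ), IsDGOP (2 * n) (2 * T) k (q k))
    (t₁ t₂ : ℝ) (ht₁ : t₁ ∈ Set.Ioo 0 T) (ht₂ : t₂ ∈ Set.Ioo 0 T) (x y : ℝ) :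
    Kabs n T p t₁ t₂ x y =
      Kcirc (2 * n) (2 * T) q (2 * t₁) (2 * t₂) x y -
      Kcirc (2 * n) (2 * T) q (2 * t₁) (2 * t₂) x (-y) := by
  have hterm : ∀ k < 2 * (n : ℕ), ∀ z : ℝ,
      ((dgNorm (2 * n) (2 * T) (q k) : ℝ) : ℂ)⁻¹ * Sdft (2 * n) (2 * T - 2 * t₁) (q k) x *
        Sdft (2 * n) (2 * t₂) (q k) z =
      1 / 2 * (((dgNorm n T (p k) : ℝ) : ℂ)⁻¹ * Sdft n (T - t₁) (p k) x *
        Sdft n t₂ (p k) z) := fun k hk z => by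
    rw [(hq k hk).unique_s8 (hp k hk).scaleRoots_half, ← mul_sub, dgNorm_scaleRoots_half,
      Sdft_scaleRoots_half, Sdft_scaleRoots_half]
    push_cast
    field_simp
  unfold Kabs Kcirc
  rw [← mul_sub, ← Finset.sum_sub_distrib]
  have hcoe : ((2 * n : ℕ+) : ℕ) = 2 * (n : ℕ) := by simp
  rw [hcoe]
  have hdiff : ∀ k ∈ Finset.range (2 * (n : ℕ)),
      ((dgNorm (2 * n) (2 * T) (q k) : ℝ) : ℂ)⁻¹ * Sdft (2 * n) (2 * T - 2 * t₁) (q k) x *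
          Sdft (2 * n) (2 * t₂) (q k) (-y) -
        ((dgNorm (2 * n) (2 * T) (q k) : ℝ) : ℂ)⁻¹ * Sdft (2 * n) (2 * T - 2 * t₁) (q k) x *
          Sdft (2 * n) (2 * t₂) (q k) (- -y) =
      (1 - (-1) ^ k) / 2 * (((dgNorm n T (p k) : ℝ) : ℂ)⁻¹ * Sdft n (T - t₁) (p k) x *
        Sdft n t₂ (p k) (-y)) := fun k hk => by
    have hk' := Finset.mem_range.mp hk
    rw [hterm k hk', hterm k hk', (hp k hk').Sdft_neg t₂ (-y)]
    ring
  rw [Finset.sum_congr rfl hdiff, sum_range_two_mul_of_even_eq_zero _ _ fun k => by simp]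
  congr 1
  · push_cast
    field_simp
  · exact Finset.sum_congr rfl fun k _ => by norm_num [pow_succ, pow_mul]
end

section
/- Let ν ∈ ℝ, let I ⊆ ℝ be an open interval, and let q : I → ℝ be twice differentiable with q''(σ) = 2q(σ)³ + σ·q(σ) − ν and 2q(σ)² − 2q'(σ) + σ ≠ 0 for all σ ∈ I. Then the Bäcklund transform q̃(σ) = −q(σ) + (2ν+1)/(2q(σ)² − 2q'(σ) + σ) is twice differentiable on I and satisfies the Painlevé II equation with parameter ν+1: q̃''(σ) = 2q̃(σ)³ + σ·q̃(σ) − (ν+1) for all σ ∈ I. -/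
/-- Along a solution of Painlevé II, `u = (2ν + 1) / (2q² - 2q' + σ)` satisfies the Riccati
equation `u' = 2qu - u²`. -/
lemma hasDerivAt_backlund_quotient {ν σ p : ℝ} {q q' : ℝ → ℝ} (hq : HasDerivAt q (q' σ) σ)
    (hq' : HasDerivAt q' p σ) (hode : p = 2 * q σ ^ 3 + σ * q σ - ν)
    (hden : 2 * q σ ^ 2 - 2 * q' σ + σ ≠ 0) :
    HasDerivAt (fun x => (2 * ν + 1) / (2 * q x ^ 2 - 2 * q' x + x))
      (2 * q σ * ((2 * ν + 1) / (2 * q σ ^ 2 - 2 * q' σ + σ)) -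
        ((2 * ν + 1) / (2 * q σ ^ 2 - 2 * q' σ + σ)) ^ 2) σ := by
  have hD : HasDerivAt (fun x => 2 * q x ^ 2 - 2 * q' x + x)
      (-2 * q σ * (2 * q σ ^ 2 - 2 * q' σ + σ) + (2 * ν + 1)) σ := by
    refine ((((hq.fun_pow 2).const_mul 2).fun_sub (hq'.const_mul 2)).fun_add
      (hasDerivAt_id' σ)).congr_deriv ?_
    rw [hode]
    push_cast
    ring
  refine ((hasDerivAt_const σ (2 * ν + 1)).fun_div hD hden).congr_deriv ?_
  generalize 2 * q σ ^ 2 - 2 * q' σ + σ = D at hden ⊢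
  field_simp
  ring

/-- The Bäcklund transformation maps a solution of the Painlevé II equation with
parameter `ν` to a solution with parameter `ν + 1`. -/
theorem backlund_transform_solves_PII (ν a b : ℝ) (q q' q'' : ℝ → ℝ)
    (hq : ∀ σ ∈ Set.Ioo a b, HasDerivAt q (q' σ) σ)
    (hq' : ∀ σ ∈ Set.Ioo a b, HasDerivAt q' (q'' σ) σ)
    (hode : ∀ σ ∈ Set.Ioo a b, q'' σ = 2 * q σ ^ 3 + σ * q σ - ν)
    (hden : ∀ σ ∈ Set.Ioo a b, 2 * q σ ^ 2 - 2 * q' σ + σ ≠ 0) :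
    ∃ qt' qt'' : ℝ → ℝ, ∀ σ ∈ Set.Ioo a b,
      HasDerivAt (fun x => -q x + (2 * ν + 1) / (2 * q x ^ 2 - 2 * q' x + x)) (qt' σ) σ ∧
      HasDerivAt qt' (qt'' σ) σ ∧
      qt'' σ = 2 * (-q σ + (2 * ν + 1) / (2 * q σ ^ 2 - 2 * q' σ + σ)) ^ 3 +
        σ * (-q σ + (2 * ν + 1) / (2 * q σ ^ 2 - 2 * q' σ + σ)) - (ν + 1) := by
  let u : ℝ → ℝ := fun x => (2 * ν + 1) / (2 * q x ^ 2 - 2 * q' x + x)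
  refine ⟨fun x => -q' x + (2 * q x * u x - u x ^ 2),
    fun x => -q'' x + (2 * q' x * u x + 2 * q x * (2 * q x * u x - u x ^ 2) -
      2 * u x * (2 * q x * u x - u x ^ 2)), fun σ hσ => ?_⟩
  have hu : HasDerivAt u (2 * q σ * u σ - u σ ^ 2) σ :=
    hasDerivAt_backlund_quotient (hq σ hσ) (hq' σ hσ) (hode σ hσ) (hden σ hσ)
  refine ⟨(hq σ hσ).fun_neg.fun_add hu, ?_, ?_⟩
  · refine ((hq' σ hσ).fun_neg.fun_add
      ((((hq σ hσ).const_mul 2).fun_mul hu).fun_sub (hu.fun_pow 2))).congr_deriv ?_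
    push_cast
    ring
  · have huD : u σ * (2 * q σ ^ 2 - 2 * q' σ + σ) = 2 * ν + 1 :=
      div_mul_cancel₀ _ (hden σ hσ)
    change _ = 2 * (-q σ + u σ) ^ 3 + σ * (-q σ + u σ) - (ν + 1)
    beta_reduce
    rw [hode σ hσ]
    linear_combination -huD
end

section
/- Let ν ∈ ℝ, let I ⊆ ℝ be an open interval, and let q : I → ℝ be twice differentiable with q''(σ) = 2q(σ)³ + σ·q(σ) − ν and 2q(σ)² − 2q'(σ) + σ ≠ 0 on I, and let q̃ be the Bäcklund transform of q. Define the Hamiltonians u(σ) = q'(σ)² − σ·q(σ)² − q(σ)⁴ + 2ν·q(σ) and ũ(σ) = q̃'(σ)² − σ·q̃(σ)² − q̃(σ)⁴ + 2(ν+1)·q̃(σ). Then ũ(σ) − u(σ) = q̃(σ) + q(σ) for all σ ∈ I. -/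
/-- The Bäcklund transform `q̃ = -q + w`, with `w = (2ν + 1) / (2q² - 2q' + σ)`, of a Painlevé II
solution has derivative `-q' + 2qw - w²`. -/
theorem hasDerivAt_backlund {ν σ : ℝ} {q q' : ℝ → ℝ} (hq : HasDerivAt q (q' σ) σ)
    (hq' : HasDerivAt q' (2 * q σ ^ 3 + σ * q σ - ν) σ)
    (hden : 2 * q σ ^ 2 - 2 * q' σ + σ ≠ 0) :
    HasDerivAt (fun x => -q x + (2 * ν + 1) / (2 * q x ^ 2 - 2 * q' x + x))
      (-q' σ + 2 * q σ * ((2 * ν + 1) / (2 * q σ ^ 2 - 2 * q' σ + σ))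
        - ((2 * ν + 1) / (2 * q σ ^ 2 - 2 * q' σ + σ)) ^ 2) σ := by
  have hD : HasDerivAt (fun x => 2 * q x ^ 2 - 2 * q' x + x)
      (-2 * q σ * (2 * q σ ^ 2 - 2 * q' σ + σ) + (2 * ν + 1)) σ := by
    refine ((((hq.fun_pow 2).const_mul 2).fun_sub (hq'.const_mul 2)).fun_add
      (hasDerivAt_id' σ)).congr_deriv ?_
    push_cast
    ring
  refine (hq.fun_neg.fun_add
    ((hasDerivAt_const σ (2 * ν + 1)).fun_div hD hden)).congr_deriv ?_
  generalize 2 * q σ ^ 2 - 2 * q' σ + σ = D at hden ⊢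
  field_simp
  ring

/-- The Hamiltonians of a Painlevé II solution and of its Bäcklund transform differ by
the sum of the two solutions. -/
theorem backlund_hamiltonian_difference (ν a b : ℝ) (q q' q'' : ℝ → ℝ)
    (hq : ∀ σ ∈ Set.Ioo a b, HasDerivAt q (q' σ) σ)
    (hq' : ∀ σ ∈ Set.Ioo a b, HasDerivAt q' (q'' σ) σ)
    (hode : ∀ σ ∈ Set.Ioo a b, q'' σ = 2 * q σ ^ 3 + σ * q σ - ν)
    (hden : ∀ σ ∈ Set.Ioo a b, 2 * q σ ^ 2 - 2 * q' σ + σ ≠ 0)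
    (qt : ℝ → ℝ) (hqt : ∀ x, qt x = -q x + (2 * ν + 1) / (2 * q x ^ 2 - 2 * q' x + x))
    (u ut : ℝ → ℝ)
    (hu : ∀ x, u x = q' x ^ 2 - x * q x ^ 2 - q x ^ 4 + 2 * ν * q x)
    (hut : ∀ x, ut x = (deriv qt x) ^ 2 - x * qt x ^ 2 - qt x ^ 4 + 2 * (ν + 1) * qt x) :
    ∀ σ ∈ Set.Ioo a b, ut σ - u σ = qt σ + q σ := by
  intro σ hσ
  have hderiv := (hasDerivAt_backlund (hq σ hσ) (hode σ hσ ▸ hq' σ hσ) (hden σ hσ)).deriv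
  rw [← funext hqt] at hderiv
  have hw := div_mul_cancel₀ (2 * ν + 1) (hden σ hσ)
  rw [hut, hu, hderiv, hqt]
  generalize (2 * ν + 1) / (2 * q σ ^ 2 - 2 * q' σ + σ) = w at hw ⊢
  linear_combination (2 * q σ - w) * hw
end

section
/- Let ν ∈ ℝ, let I ⊆ ℝ be an open interval, and let q : I → ℝ be twice differentiable with q''(σ) = 2q(σ)³ + σ·q(σ) − ν and 2q(σ)² − 2q'(σ) + σ ≠ 0 on I. Define α(σ) = 2^{−1/3}·(2ν+1)/(2q(σ)² − 2q'(σ) + σ). Then α is differentiable on I and α'(σ) = 2·α(σ)·q(σ) − 2^{1/3}·α(σ)² for all σ ∈ I. -/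
/-- The derivative identity `α' = 2αq − 2^{1/3}α²` for
`α(σ) = 2^{−1/3}(2ν+1)/(2q(σ)² − 2q'(σ) + σ)` along a Painlevé II solution `q`. -/
theorem alpha_derivative_identity (ν a b : ℝ) (q q' q'' : ℝ → ℝ)
    (hq : ∀ σ ∈ Set.Ioo a b, HasDerivAt q (q' σ) σ)
    (hq' : ∀ σ ∈ Set.Ioo a b, HasDerivAt q' (q'' σ) σ)
    (hode : ∀ σ ∈ Set.Ioo a b, q'' σ = 2 * q σ ^ 3 + σ * q σ - ν)
    (hden : ∀ σ ∈ Set.Ioo a b, 2 * q σ ^ 2 - 2 * q' σ + σ ≠ 0)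
    (α : ℝ → ℝ)
    (hα : ∀ x, α x = 2 ^ (-(1 : ℝ) / 3) * (2 * ν + 1) / (2 * q x ^ 2 - 2 * q' x + x)) :
    ∀ σ ∈ Set.Ioo a b,
      HasDerivAt α (2 * α σ * q σ - 2 ^ ((1 : ℝ) / 3) * α σ ^ 2) σ := by
  intro σ hσ
  have hD := hden σ hσ
  have hc : (2 : ℝ) ^ ((1 : ℝ) / 3) * 2 ^ (-(1 : ℝ) / 3) = 1 := by
    rw [← Real.rpow_add two_pos]
    norm_num
  have hden_deriv : HasDerivAt (fun x => 2 * q x ^ 2 - 2 * q' x + x)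
      (2 * ν + 1 - 2 * q σ * (2 * q σ ^ 2 - 2 * q' σ + σ)) σ := by
    refine (((((hq σ hσ).fun_pow 2).const_mul 2).fun_sub ((hq' σ hσ).const_mul 2)).fun_add
      (hasDerivAt_id' σ)).congr_deriv ?_
    rw [hode σ hσ]
    push_cast
    ring
  rw [hα σ, funext hα]
  generalize (2 : ℝ) ^ (-(1 : ℝ) / 3) = c at hc ⊢
  generalize (2 : ℝ) ^ ((1 : ℝ) / 3) = d at hc ⊢
  refine ((hasDerivAt_const σ (c * (2 * ν + 1))).fun_div hden_deriv hD).congr_deriv ?_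
  generalize 2 * q σ ^ 2 - 2 * q' σ + σ = D at hD ⊢
  field_simp
  linear_combination (c * (2 * ν + 1) ^ 2) * hc
end

section
/- For all complex numbers c, d, g, a, b, h, x, y: D(x,y)·V(x) − V(y)·D(x,y) = −2i(x² − y²)·E, where V(z) = 2·M(z) with M(z) the 4×4 matrix with rows (c, d, −i, 0), (d, c, 0, i), (i(−z+g+a), i(b−h), −c, −d), (i(h−b), −i(z+g+a), −d, −c), D(x,y) is the 4×4 matrix with rows (x+y, −x+y, 0, 0), (−x+y, x+y, 0, 0), (0, 0, x+y, x−y), (0, 0, x−y, x+y), and E is the 4×4 matrix whose lower-left 2×2 block is the all-ones matrix J₂ and whose other entries are 0. -/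
open Complex Matrix

/-- The coefficient matrix `V(z)` of the `s`-equation of the 4×4 Lax pair associated
to the Painlevé II equation, with parameters `c, d, g, a, b, h`. -/
def Vmat (c d g a b h z : ℂ) : Matrix (Fin 4) (Fin 4) ℂ :=
  (2 : ℂ) • !![c, d, -I, 0;
               d, c, 0, I;
               I * (-z + g + a), I * (b - h), -c, -d;
               I * (h - b), -I * (z + g + a), -d, -c]

/-- The symmetrizing matrix `D(x,y)` appearing in the hard-edge tacnode kernel. -/
def Dmat (x y : ℂ) : Matrix (Fin 4) (Fin 4) ℂ :=
  !![x + y, -x + y, 0, 0;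
     -x + y, x + y, 0, 0;
     0, 0, x + y, x - y;
     0, 0, x - y, x + y]

/-- The matrix whose lower-left 2×2 block is the all-ones matrix and whose other
entries vanish. -/
def Emat : Matrix (Fin 4) (Fin 4) ℂ :=
  !![0, 0, 0, 0;
     0, 0, 0, 0;
     1, 1, 0, 0;
     1, 1, 0, 0]

theorem Dmat_Vmat_commutator (c d g a b h x y : ℂ) :
    Dmat x y * Vmat c d g a b h x - Vmat c d g a b h y * Dmat x y =
      (-2 * I * (x ^ 2 - y ^ 2)) • Emat := by
  ext i j
  fin_cases i <;> fin_cases j <;>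
    simp [Dmat, Vmat, Emat] <;> ring
end

section
/- Let q : ℝ → ℂ be a function, let u, v ∈ ℂ with u² ≠ v², and let f₁, g₁, f₂, g₂ : ℝ → ℂ be differentiable functions satisfying f₁'(σ) = −iu·f₁(σ) + q(σ)·g₁(σ), g₁'(σ) = q(σ)·f₁(σ) + iu·g₁(σ), f₂'(σ) = −iv·f₂(σ) + q(σ)·g₂(σ), g₂'(σ) = q(σ)·f₂(σ) + iv·g₂(σ). Then for every σ ∈ ℝ, the derivative with respect to σ of [(u+v)(f₁(σ)g₂(σ) − g₁(σ)f₂(σ)) + (u−v)(f₁(σ)f₂(σ) − g₁(σ)g₂(σ))] / (2πi(u² − v²)) equals −(f₁(σ) + g₁(σ))·(f₂(σ) + g₂(σ))/(2π). -/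
/-- The σ-derivative of the combination appearing in the even/odd tacnode kernels is a
rank-one expression, for solutions of the Flaschka–Newell σ-equations at spectral
parameters `u` and `v`. -/
theorem tacnode_kernel_sigma_derivative (q : ℝ → ℂ) (u v : ℂ) (huv : u ^ 2 ≠ v ^ 2)
    (f₁ g₁ f₂ g₂ : ℝ → ℂ)
    (hf₁ : ∀ σ : ℝ, HasDerivAt f₁ (-Complex.I * u * f₁ σ + q σ * g₁ σ) σ)
    (hg₁ : ∀ σ : ℝ, HasDerivAt g₁ (q σ * f₁ σ + Complex.I * u * g₁ σ) σ)
    (hf₂ : ∀ σ : ℝ, HasDerivAt f₂ (-Complex.I * v * f₂ σ + q σ * g₂ σ) σ)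
    (hg₂ : ∀ σ : ℝ, HasDerivAt g₂ (q σ * f₂ σ + Complex.I * v * g₂ σ) σ) :
    ∀ σ : ℝ, HasDerivAt
      (fun σ' => ((u + v) * (f₁ σ' * g₂ σ' - g₁ σ' * f₂ σ') +
          (u - v) * (f₁ σ' * f₂ σ' - g₁ σ' * g₂ σ')) /
        (2 * (Real.pi : ℂ) * Complex.I * (u ^ 2 - v ^ 2)))
      (-((f₁ σ + g₁ σ) * (f₂ σ + g₂ σ)) / (2 * (Real.pi : ℂ))) σ := by
  intro σ
  have hsub : u ^ 2 - v ^ 2 ≠ 0 := sub_ne_zero.mpr huv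
  have hpi : (Real.pi : ℂ) ≠ 0 := Complex.ofReal_ne_zero.mpr Real.pi_ne_zero
  have hcross := ((hf₁ σ).mul (hg₂ σ)).sub ((hg₁ σ).mul (hf₂ σ))
  have hdiag := ((hf₁ σ).mul (hf₂ σ)).sub ((hg₁ σ).mul (hg₂ σ))
  refine (((hcross.const_mul (u + v)).add (hdiag.const_mul (u - v))).div_const
    (2 * (Real.pi : ℂ) * Complex.I * (u ^ 2 - v ^ 2))).congr_deriv ?_
  rw [div_eq_div_iff (by simp [hpi, hsub]) (by simp [hpi])]
  ring
end

section
/- For all real s, t and all ξ > 0, η > 0, every integral below converges and the even Pearcey kernel is related to the hard-edge Pearcey kernel with parameter α = −1/2 by K^{even}_{s,t}(ξ, η) = (η/√2) · K^{(−1/2)}_{s/√2, t/√2}(2^{−3/2} ξ², 2^{−3/2} η²). -/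
open MeasureTheory

/-- The unit direction `e^{ikπ/4}`. -/
noncomputable def ray (k : ℕ) : ℂ := Complex.exp ((k : ℂ) * Real.pi * Complex.I / 4)

/-- The Gaussian factor `φ_{s,t}(ξ,η)`. -/
noncomputable def phiP (s t ξ η : ℝ) : ℝ :=
  (Real.sqrt (2 * Real.pi * (t - s)))⁻¹ * Real.exp (-(ξ - η) ^ 2 / (2 * (t - s)))

/-- The integrand of the even Pearcey kernel. -/
noncomputable def evenIntegrand (s t ξ η : ℝ) (z : ℂ) (w : ℝ) : ℂ :=
  Complex.exp (z ^ 4 / 4 + (s : ℂ) * z ^ 2 / 2 - (w : ℂ) ^ 4 / 4 - (t : ℂ) * (w : ℂ) ^ 2 / 2) *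
    z * Complex.cos ((ξ : ℂ) * z) * Complex.cos ((η : ℂ) * (w : ℂ)) / (z ^ 2 - (w : ℂ) ^ 2)

/-- The contour integral over `X` (four rays at angles `π/4, 3π/4, 5π/4, 7π/4`,
the first and third oriented towards the origin). -/
noncomputable def intX (F : ℂ → ℂ) : ℂ :=
  -(∫ r in Set.Ioi (0 : ℝ), F ((r : ℂ) * ray 1) * ray 1)
    - (∫ r in Set.Ioi (0 : ℝ), F ((r : ℂ) * ray 5) * ray 5)
    + (∫ r in Set.Ioi (0 : ℝ), F ((r : ℂ) * ray 3) * ray 3)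
    + (∫ r in Set.Ioi (0 : ℝ), F ((r : ℂ) * ray 7) * ray 7)

/-- The contour integral over `C` (the ray at angle `π/4` oriented towards the origin
followed by the ray at angle `−π/4` oriented away from it). -/
noncomputable def intC (F : ℂ → ℂ) : ℂ :=
  -(∫ r in Set.Ioi (0 : ℝ), F ((r : ℂ) * ray 1) * ray 1)
    + (∫ r in Set.Ioi (0 : ℝ), F ((r : ℂ) * ray 7) * ray 7)

/-- The double integral part `K̃^{even}` of the even Pearcey kernel. -/
noncomputable def KtildeEven (s t ξ η : ℝ) : ℂ :=
  (1 / (2 * (Real.pi : ℂ) ^ 2 * Complex.I)) *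
    intX (fun z => ∫ w : ℝ, evenIntegrand s t ξ η z w)

/-- The even Pearcey kernel `K^{even}_{s,t}(ξ,η)`. -/
noncomputable def KPearceyEven (s t ξ η : ℝ) : ℂ :=
  KtildeEven s t ξ η - (if s < t then ((phiP s t ξ η + phiP s t ξ (-η) : ℝ) : ℂ) else 0)

/-- The integrand of the hard-edge Pearcey kernel with parameter `α = −1/2`. -/
noncomputable def hardIntegrandNeg (σ τ x y : ℝ) (v : ℂ) (u : ℝ) : ℂ :=
  Complex.exp (v ^ 4 / 2 + (σ : ℂ) * v ^ 2 - (u : ℂ) ^ 4 / 2 - (τ : ℂ) * (u : ℂ) ^ 2) *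
    Complex.cos (2 * (Real.sqrt y : ℂ) * (u : ℂ)) * Complex.cos (2 * (Real.sqrt x : ℂ) * v) *
    v / (v ^ 2 - (u : ℂ) ^ 2)

/-- The double integral part `K̃^{(−1/2)}` of the hard-edge Pearcey kernel with
parameter `α = −1/2`. -/
noncomputable def KtildeHardNeg (σ τ x y : ℝ) : ℂ :=
  (2 / ((Real.pi : ℂ) ^ 2 * Complex.I)) * ((Real.sqrt y : ℝ) : ℂ)⁻¹ *
    intC (fun v => ∫ u in Set.Ioi (0 : ℝ), hardIntegrandNeg σ τ x y v u)

/-- The Gaussian part `φ^{(−1/2)}` of the hard-edge Pearcey kernel with `α = −1/2`. -/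
noncomputable def phiHardNeg (σ τ x y : ℝ) : ℝ :=
  (1 / (2 * Real.sqrt Real.pi)) * (Real.sqrt (τ - σ))⁻¹ * (Real.sqrt y)⁻¹ *
    (Real.exp (-(Real.sqrt x - Real.sqrt y) ^ 2 / (τ - σ)) +
      Real.exp (-(Real.sqrt x + Real.sqrt y) ^ 2 / (τ - σ)))

/-- The hard-edge Pearcey kernel with parameter `α = −1/2`. -/
noncomputable def KHardNeg (σ τ x y : ℝ) : ℂ :=
  KtildeHardNeg σ τ x y - (if σ < τ then ((phiHardNeg σ τ x y : ℝ) : ℂ) else 0)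

lemma ray_add_four (k : ℕ) : ray (k + 4) = -ray k := by
  have h : ((k + 4 : ℕ) : ℂ) * Real.pi * Complex.I / 4 =
      (k : ℂ) * Real.pi * Complex.I / 4 + Real.pi * Complex.I := by
    push_cast; ring
  rw [ray, h, Complex.exp_add, Complex.exp_pi_mul_I, ray]
  ring

lemma norm_ray (k : ℕ) : ‖ray k‖ = 1 := by
  have h : (k : ℂ) * Real.pi * Complex.I / 4 = ((k * Real.pi / 4 : ℝ) : ℂ) * Complex.I := by
    push_cast; ring
  rw [ray, h, Complex.norm_exp_ofReal_mul_I]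

lemma ray_one_sq : ray 1 ^ 2 = Complex.I := by
  have h : ((2 : ℕ) : ℂ) * (((1 : ℕ) : ℂ) * Real.pi * Complex.I / 4) =
      Real.pi / 2 * Complex.I := by
    push_cast; ring
  rw [ray, ← Complex.exp_nat_mul, h, Complex.exp_pi_div_two_mul_I]

lemma ray_three_sq : ray 3 ^ 2 = -Complex.I := by
  have h : ((2 : ℕ) : ℂ) * (((3 : ℕ) : ℂ) * Real.pi * Complex.I / 4) =
      Real.pi / 2 * Complex.I + Real.pi * Complex.I := by
    push_cast; ring
  rw [ray, ← Complex.exp_nat_mul, h, Complex.exp_add, Complex.exp_pi_div_two_mul_I,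
    Complex.exp_pi_mul_I]
  ring

lemma ray_sq_re_eq_zero {d : ℕ} (hd : d ∈ ({1, 3, 5, 7} : Finset ℕ)) : (ray d ^ 2).re = 0 := by
  simp only [Finset.mem_insert, Finset.mem_singleton] at hd
  rcases hd with rfl | rfl | rfl | rfl
  · simp [ray_one_sq]
  · simp [ray_three_sq]
  · simp [ray_add_four 1, ray_one_sq]
  · simp [ray_add_four 3, ray_three_sq]

lemma norm_cos_le_exp_norm (z : ℂ) : ‖Complex.cos z‖ ≤ Real.exp ‖z‖ := by
  have h (w : ℂ) (hw : ‖w‖ = ‖z‖) : ‖Complex.exp w‖ ≤ Real.exp ‖z‖ := by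
    rw [Complex.norm_exp, Real.exp_le_exp, ← hw]
    exact Complex.re_le_norm w
  rw [Complex.cos, norm_div, Complex.norm_ofNat]
  have := norm_add_le (Complex.exp (z * Complex.I)) (Complex.exp (-z * Complex.I))
  linarith [h (z * Complex.I) (by simp), h (-z * Complex.I) (by simp)]

/-- On the lines `Re z² = 0` the integrand is dominated by a Poisson kernel in `w` times a rapidly
decaying function of `‖z‖`. -/
lemma norm_evenIntegrand_le (s t ξ η : ℝ) (hξ : 0 ≤ ξ) {z : ℂ} (hz : (z ^ 2).re = 0)
    (hz0 : z ≠ 0) (w : ℝ) :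
    ‖evenIntegrand s t ξ η z w‖ ≤
      2 * Real.exp (t ^ 2 / 4) * Real.exp (ξ * ‖z‖ - ‖z‖ ^ 4 / 4) *
        (‖z‖ / (‖z‖ ^ 2 + w ^ 2)) := by
  set r := ‖z‖ with hr
  have hr0 : 0 < r := norm_pos_iff.mpr hz0
  obtain ⟨b, hb⟩ : ∃ b : ℝ, z ^ 2 = b * Complex.I :=
    ⟨(z ^ 2).im, by apply Complex.ext <;> simp [hz]⟩
  have hb2 : b ^ 2 = r ^ 4 := by
    have h : ‖z ^ 2‖ = |b| := by simp [hb]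
    rw [norm_pow, ← hr] at h
    rw [← sq_abs, ← h]; ring
  have hz4 : z ^ 4 = ((-r ^ 4 : ℝ) : ℂ) := by
    rw [show z ^ 4 = (z ^ 2) ^ 2 by ring, hb, ← hb2]
    push_cast
    rw [mul_pow, Complex.I_sq]; ring
  have hexp : ‖Complex.exp (z ^ 4 / 4 + (s : ℂ) * z ^ 2 / 2 - (w : ℂ) ^ 4 / 4
      - (t : ℂ) * (w : ℂ) ^ 2 / 2)‖ ≤ Real.exp (t ^ 2 / 4) * Real.exp (-r ^ 4 / 4) := by
    have h : z ^ 4 / 4 + (s : ℂ) * z ^ 2 / 2 - (w : ℂ) ^ 4 / 4 - (t : ℂ) * (w : ℂ) ^ 2 / 2 =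
        ((-r ^ 4 / 4 - w ^ 4 / 4 - t * w ^ 2 / 2 : ℝ) : ℂ) + ((s * b / 2 : ℝ) : ℂ) * Complex.I := by
      rw [hz4, hb]; push_cast; ring
    rw [h, Complex.norm_exp, ← Real.exp_add, Real.exp_le_exp]
    simp only [Complex.add_re, Complex.ofReal_re, Complex.re_ofReal_mul, Complex.I_re, mul_zero,
      add_zero]
    nlinarith [sq_nonneg (w ^ 2 + t)]
  have hcosz : ‖Complex.cos ((ξ : ℂ) * z)‖ ≤ Real.exp (ξ * r) := by
    refine (norm_cos_le_exp_norm _).trans_eq ?_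
    rw [norm_mul, Complex.norm_real, Real.norm_of_nonneg hξ]
  have hcosw : ‖Complex.cos ((η : ℂ) * (w : ℂ))‖ ≤ 1 := by
    rw [← Complex.ofReal_mul, ← Complex.ofReal_cos, Complex.norm_real]
    exact Real.abs_cos_le_one _
  have hden : (r ^ 2 + w ^ 2) / 2 ≤ ‖z ^ 2 - (w : ℂ) ^ 2‖ := by
    have h : ‖z ^ 2 - (w : ℂ) ^ 2‖ ^ 2 = r ^ 4 + w ^ 4 := by
      rw [← Complex.normSq_eq_norm_sq, hb, ← hb2,
        show (b : ℂ) * Complex.I - (w : ℂ) ^ 2 = ((-w ^ 2 : ℝ) : ℂ) + (b : ℂ) * Complex.I by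
          push_cast; ring, Complex.normSq_add_mul_I]
      ring
    refine le_of_sq_le_sq ?_ (norm_nonneg _)
    rw [h]
    nlinarith [sq_nonneg (r ^ 2 - w ^ 2), sq_nonneg (r ^ 2), sq_nonneg (w ^ 2)]
  have hpos : 0 < r ^ 2 + w ^ 2 := by positivity
  rw [evenIntegrand, norm_div, norm_mul, norm_mul, norm_mul, ← hr]
  calc _ ≤ (Real.exp (t ^ 2 / 4) * Real.exp (-r ^ 4 / 4)) * r * Real.exp (ξ * r) * 1 /
        ((r ^ 2 + w ^ 2) / 2) := by gcongr
    _ = _ := by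
      rw [sub_eq_add_neg, Real.exp_add, ← neg_div]
      field_simp

lemma div_sq_add_sq_eq {r : ℝ} (hr : 0 < r) (w : ℝ) :
    r / (r ^ 2 + w ^ 2) = r⁻¹ * (1 + (r⁻¹ * w) ^ 2)⁻¹ := by
  field_simp

lemma integrable_div_sq_add_sq {r : ℝ} (hr : 0 < r) :
    Integrable (fun w : ℝ => r / (r ^ 2 + w ^ 2)) := by
  simp_rw [div_sq_add_sq_eq hr]
  exact (integrable_inv_one_add_sq.comp_mul_left' (inv_ne_zero hr.ne')).const_mul _

lemma integral_univ_div_sq_add_sq {r : ℝ} (hr : 0 < r) :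
    ∫ w : ℝ, r / (r ^ 2 + w ^ 2) = Real.pi := by
  simp_rw [div_sq_add_sq_eq hr]
  rw [integral_const_mul, Measure.integral_comp_mul_left (fun x : ℝ => (1 + x ^ 2)⁻¹) r⁻¹,
    integral_univ_inv_one_add_sq, inv_inv, abs_of_pos hr, smul_eq_mul, inv_mul_cancel_left₀ hr.ne']

lemma measurable_evenIntegrand (s t ξ η : ℝ) :
    Measurable (fun p : ℂ × ℝ => evenIntegrand s t ξ η p.1 p.2) := by
  unfold evenIntegrand
  fun_prop

lemma integrable_evenIntegrand (s t ξ η : ℝ) (hξ : 0 ≤ ξ) {z : ℂ} (hz : (z ^ 2).re = 0)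
    (hz0 : z ≠ 0) : Integrable (fun w : ℝ => evenIntegrand s t ξ η z w) :=
  ((integrable_div_sq_add_sq (norm_pos_iff.mpr hz0)).const_mul _).mono'
    ((measurable_evenIntegrand s t ξ η).comp measurable_prodMk_left).aestronglyMeasurable
    (.of_forall (norm_evenIntegrand_le s t ξ η hξ hz hz0))

lemma norm_integral_evenIntegrand_le (s t ξ η : ℝ) (hξ : 0 ≤ ξ) {z : ℂ} (hz : (z ^ 2).re = 0)
    (hz0 : z ≠ 0) :
    ‖∫ w : ℝ, evenIntegrand s t ξ η z w‖ ≤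
      2 * Real.exp (t ^ 2 / 4) * Real.exp (ξ * ‖z‖ - ‖z‖ ^ 4 / 4) * Real.pi := by
  have hr := norm_pos_iff.mpr hz0
  rw [← integral_univ_div_sq_add_sq hr, ← integral_const_mul]
  exact norm_integral_le_of_norm_le ((integrable_div_sq_add_sq hr).const_mul _)
    (.of_forall (norm_evenIntegrand_le s t ξ η hξ hz hz0))

lemma integrableOn_exp_linear_sub_quartic (ξ : ℝ) :
    IntegrableOn (fun r : ℝ => Real.exp (ξ * r - r ^ 4 / 4)) (Set.Ioi 0) := by
  refine ((integrableOn_exp_neg_Ioi 0).const_mul (Real.exp ((ξ + 1) ^ 2 / 4 + 1))).mono'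
    (by fun_prop) (.of_forall fun r => ?_)
  rw [Real.norm_of_nonneg (Real.exp_pos _).le, ← Real.exp_add, Real.exp_le_exp]
  nlinarith [sq_nonneg (r ^ 2 / 2 - 1), sq_nonneg (r - (ξ + 1) / 2)]

lemma ray_ne_zero (d : ℕ) : ray d ≠ 0 := Complex.exp_ne_zero _

lemma ofReal_mul_ray_sq_re {d : ℕ} (hd : d ∈ ({1, 3, 5, 7} : Finset ℕ)) (r : ℝ) :
    (((r : ℂ) * ray d) ^ 2).re = 0 := by
  rw [mul_pow, ← Complex.ofReal_pow, Complex.re_ofReal_mul, ray_sq_re_eq_zero hd, mul_zero]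

lemma ofReal_mul_ray_ne_zero (d : ℕ) {r : ℝ} (hr : 0 < r) : (r : ℂ) * ray d ≠ 0 :=
  mul_ne_zero (Complex.ofReal_ne_zero.mpr hr.ne') (ray_ne_zero d)

lemma integrableOn_integral_evenIntegrand (s t ξ η : ℝ) (hξ : 0 ≤ ξ) {d : ℕ}
    (hd : d ∈ ({1, 3, 5, 7} : Finset ℕ)) :
    IntegrableOn
      (fun r : ℝ => (∫ w : ℝ, evenIntegrand s t ξ η ((r : ℂ) * ray d) w) * ray d)
      (Set.Ioi 0) := by
  refine Integrable.mul_const ?_ _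
  have hmeas : StronglyMeasurable
      (fun r : ℝ => ∫ w : ℝ, evenIntegrand s t ξ η ((r : ℂ) * ray d) w) := by
    refine StronglyMeasurable.integral_prod_right'
      (f := fun p : ℝ × ℝ => evenIntegrand s t ξ η ((p.1 : ℂ) * ray d) p.2) ?_
    have h : Measurable (fun p : ℝ × ℝ => ((p.1 : ℂ) * ray d, p.2)) := by fun_prop
    exact ((measurable_evenIntegrand s t ξ η).comp h).stronglyMeasurable
  refine (((integrableOn_exp_linear_sub_quartic ξ).const_mul
    (2 * Real.exp (t ^ 2 / 4))).mul_const Real.pi).mono' hmeas.aestronglyMeasurable ?_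
  filter_upwards [ae_restrict_mem measurableSet_Ioi] with r hr
  have h := norm_integral_evenIntegrand_le s t ξ η hξ (ofReal_mul_ray_sq_re hd r)
    (ofReal_mul_ray_ne_zero d hr)
  rwa [norm_mul, norm_ray, mul_one, Complex.norm_real, Real.norm_of_nonneg (le_of_lt hr)] at h

lemma integral_eq_two_mul_integral_Ioi {f : ℝ → ℂ} (hf : Integrable f) (heven : ∀ x, f (-x) = f x) :
    ∫ x, f x = 2 * ∫ x in Set.Ioi (0 : ℝ), f x := by
  have h := integral_comp_neg_Iic (0 : ℝ) f
  simp only [heven, neg_zero] at h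
  rw [← intervalIntegral.integral_Iic_add_Ioi hf.integrableOn hf.integrableOn (b := 0), h, two_mul]

lemma evenIntegrand_neg_right (s t ξ η : ℝ) (z : ℂ) (w : ℝ) :
    evenIntegrand s t ξ η z (-w) = evenIntegrand s t ξ η z w := by
  simp [evenIntegrand, Even.neg_pow (by decide : Even 4)]

lemma evenIntegrand_neg_left (s t ξ η : ℝ) (z : ℂ) (w : ℝ) :
    evenIntegrand s t ξ η (-z) w = -evenIntegrand s t ξ η z w := by
  simp [evenIntegrand, Even.neg_pow (by decide : Even 4), neg_div]

lemma intX_eq_two_mul_intC {F : ℂ → ℂ} (hF : ∀ z, F (-z) = -F z) : intX F = 2 * intC F := by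
  have h5 : ray 5 = -ray 1 := ray_add_four 1
  have h7 : ray 7 = -ray 3 := ray_add_four 3
  simp only [intX, intC, h5, h7, mul_neg, hF, neg_mul, neg_neg]
  ring

section Scaling

variable {L : ℝ}

lemma sqrt_two_eq_sq (hL4 : L ^ 4 = 2) : Real.sqrt 2 = L ^ 2 := by
  rw [← hL4, show L ^ 4 = (L ^ 2) ^ 2 by ring, Real.sqrt_sq (sq_nonneg L)]

lemma sqrt_two_rpow_mul_sq (hL : 0 < L) (hL4 : L ^ 4 = 2) {x : ℝ} (hx : 0 ≤ x) :
    Real.sqrt ((2 : ℝ) ^ (-(3 : ℝ) / 2) * x ^ 2) = x / L ^ 3 := by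
  have h : (2 : ℝ) ^ (-(3 : ℝ) / 2) = (L ^ 6)⁻¹ := by
    have h4 : (2 : ℝ) = L ^ (4 : ℝ) := by rw [← hL4]; norm_cast
    rw [show -(3 : ℝ) / 2 = -(6 / 4) by norm_num, h4, ← Real.rpow_mul hL.le, ← Real.rpow_natCast L 6,
      ← Real.rpow_neg hL.le]
    norm_num
  rw [h, show (L ^ 6)⁻¹ * x ^ 2 = (x / L ^ 3) ^ 2 by field_simp, Real.sqrt_sq (by positivity)]

lemma hardIntegrandNeg_eq (hL : 0 < L) (hL4 : L ^ 4 = 2) (s t : ℝ) {ξ η : ℝ} (hξ : 0 ≤ ξ)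
    (hη : 0 ≤ η) (v : ℂ) (u : ℝ) :
    hardIntegrandNeg (s / Real.sqrt 2) (t / Real.sqrt 2)
      ((2 : ℝ) ^ (-(3 : ℝ) / 2) * ξ ^ 2) ((2 : ℝ) ^ (-(3 : ℝ) / 2) * η ^ 2) v u =
      L * evenIntegrand s t ξ η (L * v) (L * u) := by
  have hL0 : (L : ℂ) ≠ 0 := Complex.ofReal_ne_zero.mpr hL.ne'
  have hL4' : (L : ℂ) ^ 4 = 2 := by exact_mod_cast congrArg Complex.ofReal hL4
  have hexp : v ^ 4 / 2 + (s / L ^ 2 : ℂ) * v ^ 2 - (u : ℂ) ^ 4 / 2 - (t / L ^ 2 : ℂ) * (u : ℂ) ^ 2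
      = (L * v) ^ 4 / 4 + s * (L * v) ^ 2 / 2 - (L * u) ^ 4 / 4 - t * (L * u) ^ 2 / 2 := by
    have h (a : ℂ) : a / L ^ 2 = a * L ^ 2 / 2 := by
      rw [← hL4']; field_simp
    rw [h, h, mul_pow, mul_pow (L : ℂ) (u : ℂ) 4, hL4']; ring
  have hcos (a b : ℂ) : 2 * (a / L ^ 3) * b = a * (L * b) := by
    rw [← hL4']; field_simp
  rw [hardIntegrandNeg, evenIntegrand, sqrt_two_rpow_mul_sq hL hL4 hξ,
    sqrt_two_rpow_mul_sq hL hL4 hη, sqrt_two_eq_sq hL4]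
  push_cast
  rw [hexp, hcos, hcos, mul_pow (L : ℂ) v 2, mul_pow (L : ℂ) (u : ℂ) 2, ← mul_sub, ← mul_div_assoc,
    ← mul_div_mul_left _ (v ^ 2 - (u : ℂ) ^ 2) (pow_ne_zero 2 hL0)]
  ring

lemma integral_Ioi_hardIntegrandNeg (hL : 0 < L) (hL4 : L ^ 4 = 2) (s t : ℝ) {ξ η : ℝ}
    (hξ : 0 ≤ ξ) (hη : 0 ≤ η) {v : ℂ} (hv : (v ^ 2).re = 0) (hv0 : v ≠ 0) :
    ∫ u in Set.Ioi (0 : ℝ), hardIntegrandNeg (s / Real.sqrt 2) (t / Real.sqrt 2)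
      ((2 : ℝ) ^ (-(3 : ℝ) / 2) * ξ ^ 2) ((2 : ℝ) ^ (-(3 : ℝ) / 2) * η ^ 2) v u =
      1 / 2 * ∫ w : ℝ, evenIntegrand s t ξ η (L * v) w := by
  have hL0 : (L : ℂ) ≠ 0 := Complex.ofReal_ne_zero.mpr hL.ne'
  have hLv : (((L : ℂ) * v) ^ 2).re = 0 := by
    rw [mul_pow, ← Complex.ofReal_pow, Complex.re_ofReal_mul, hv, mul_zero]
  simp_rw [hardIntegrandNeg_eq hL hL4 s t hξ hη]
  rw [integral_const_mul,
    integral_comp_mul_left_Ioi (fun w => evenIntegrand s t ξ η (L * v) w) 0 hL, mul_zero,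
    integral_eq_two_mul_integral_Ioi
      (integrable_evenIntegrand s t ξ η hξ hLv (mul_ne_zero hL0 hv0))
      (evenIntegrand_neg_right s t ξ η _), Complex.real_smul, Complex.ofReal_inv,
    mul_inv_cancel_left₀ hL0]
  ring

lemma intC_hardIntegrandNeg (hL : 0 < L) (hL4 : L ^ 4 = 2) (s t : ℝ) {ξ η : ℝ}
    (hξ : 0 ≤ ξ) (hη : 0 ≤ η) :
    intC (fun v => ∫ u in Set.Ioi (0 : ℝ), hardIntegrandNeg (s / Real.sqrt 2) (t / Real.sqrt 2)
      ((2 : ℝ) ^ (-(3 : ℝ) / 2) * ξ ^ 2) ((2 : ℝ) ^ (-(3 : ℝ) / 2) * η ^ 2) v u) =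
      (1 / (2 * L)) * intC (fun z => ∫ w : ℝ, evenIntegrand s t ξ η z w) := by
  have key {d : ℕ} (hd : d ∈ ({1, 3, 5, 7} : Finset ℕ)) :
      ∫ r in Set.Ioi (0 : ℝ), (∫ u in Set.Ioi (0 : ℝ),
        hardIntegrandNeg (s / Real.sqrt 2) (t / Real.sqrt 2)
          ((2 : ℝ) ^ (-(3 : ℝ) / 2) * ξ ^ 2) ((2 : ℝ) ^ (-(3 : ℝ) / 2) * η ^ 2)
          ((r : ℂ) * ray d) u) * ray d =
      (1 / (2 * L)) * ∫ r in Set.Ioi (0 : ℝ),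
        (∫ w : ℝ, evenIntegrand s t ξ η ((r : ℂ) * ray d) w) * ray d := by
    have h := integral_comp_mul_left_Ioi
      (fun r : ℝ => (∫ w : ℝ, evenIntegrand s t ξ η ((r : ℂ) * ray d) w) * ray d) 0 hL
    rw [mul_zero, Complex.real_smul] at h
    rw [show (1 / (2 * L) : ℂ) = 1 / 2 * ((L⁻¹ : ℝ) : ℂ) by push_cast; ring, mul_assoc, ← h,
      ← integral_const_mul]
    refine setIntegral_congr_fun measurableSet_Ioi fun r hr => ?_
    rw [integral_Ioi_hardIntegrandNeg hL hL4 s t hξ hη (ofReal_mul_ray_sq_re hd r)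
      (ofReal_mul_ray_ne_zero d hr)]
    push_cast
    simp only [mul_assoc]
  simp only [intC]
  rw [key (d := 1) (by decide), key (d := 7) (by decide)]
  ring

lemma phiP_add_phiP_neg (hL : 0 < L) (hL4 : L ^ 4 = 2) {s t ξ η : ℝ} (hst : s < t) (hξ : 0 ≤ ξ)
    (hη : 0 < η) :
    phiP s t ξ η + phiP s t ξ (-η) = η / Real.sqrt 2 *
      phiHardNeg (s / Real.sqrt 2) (t / Real.sqrt 2)
        ((2 : ℝ) ^ (-(3 : ℝ) / 2) * ξ ^ 2) ((2 : ℝ) ^ (-(3 : ℝ) / 2) * η ^ 2) := by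
  have hts : 0 < t - s := sub_pos.mpr hst
  have hexp (a : ℝ) : -(a / L ^ 3) ^ 2 / ((t - s) / L ^ 2) = -a ^ 2 / (2 * (t - s)) := by
    rw [← hL4]; field_simp
  rw [phiHardNeg, sqrt_two_rpow_mul_sq hL hL4 hξ, sqrt_two_rpow_mul_sq hL hL4 hη.le,
    sqrt_two_eq_sq hL4, ← sub_div, ← sub_div, ← add_div, hexp, hexp,
    Real.sqrt_div hts.le, Real.sqrt_sq hL.le, phiP, phiP, sub_neg_eq_add, ← mul_add,
    Real.sqrt_mul (by positivity), Real.sqrt_mul zero_le_two, sqrt_two_eq_sq hL4]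
  have h1 : 0 < Real.sqrt (t - s) := Real.sqrt_pos.mpr hts
  have h2 : 0 < Real.sqrt Real.pi := Real.sqrt_pos.mpr Real.pi_pos
  have h3 : L ^ 3 * L = 2 := by rw [← hL4]; ring
  rw [← mul_assoc]
  congr 1
  field_simp
  linear_combination -h3

end Scaling

theorem even_pearcey_eq_hard_edge_neg_half (s t ξ η : ℝ) (hξ : 0 < ξ) (hη : 0 < η) :
    (∀ d ∈ ({1, 3, 5, 7} : Finset ℕ), ∀ r ∈ Set.Ioi (0 : ℝ),
      Integrable (fun w : ℝ => evenIntegrand s t ξ η ((r : ℂ) * ray d) w)) ∧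
    (∀ d ∈ ({1, 3, 5, 7} : Finset ℕ),
      IntegrableOn
        (fun r : ℝ => (∫ w : ℝ, evenIntegrand s t ξ η ((r : ℂ) * ray d) w) * ray d)
        (Set.Ioi 0)) ∧
    (∀ d ∈ ({1, 7} : Finset ℕ), ∀ r ∈ Set.Ioi (0 : ℝ),
      IntegrableOn
        (fun u : ℝ => hardIntegrandNeg (s / Real.sqrt 2) (t / Real.sqrt 2)
          ((2 : ℝ) ^ (-(3 : ℝ) / 2) * ξ ^ 2) ((2 : ℝ) ^ (-(3 : ℝ) / 2) * η ^ 2)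
          ((r : ℂ) * ray d) u)
        (Set.Ioi 0)) ∧
    (∀ d ∈ ({1, 7} : Finset ℕ),
      IntegrableOn
        (fun r : ℝ => (∫ u in Set.Ioi (0 : ℝ),
          hardIntegrandNeg (s / Real.sqrt 2) (t / Real.sqrt 2)
            ((2 : ℝ) ^ (-(3 : ℝ) / 2) * ξ ^ 2) ((2 : ℝ) ^ (-(3 : ℝ) / 2) * η ^ 2)
            ((r : ℂ) * ray d) u) * ray d)
        (Set.Ioi 0)) ∧
    KPearceyEven s t ξ η = ((η / Real.sqrt 2 : ℝ) : ℂ) *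
      KHardNeg (s / Real.sqrt 2) (t / Real.sqrt 2)
        ((2 : ℝ) ^ (-(3 : ℝ) / 2) * ξ ^ 2) ((2 : ℝ) ^ (-(3 : ℝ) / 2) * η ^ 2) := by
  obtain ⟨L, hL, hL4⟩ : ∃ L : ℝ, 0 < L ∧ L ^ 4 = 2 := by
    refine ⟨(2 : ℝ) ^ ((1 : ℝ) / 4), by positivity, ?_⟩
    rw [← Real.rpow_natCast, ← Real.rpow_mul zero_le_two]
    norm_num
  have hsub {d : ℕ} (hd : d ∈ ({1, 7} : Finset ℕ)) : d ∈ ({1, 3, 5, 7} : Finset ℕ) :=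
    (by decide : ({1, 7} : Finset ℕ) ⊆ {1, 3, 5, 7}) hd
  refine ⟨fun d hd r hr => integrable_evenIntegrand s t ξ η hξ.le (ofReal_mul_ray_sq_re hd r)
      (ofReal_mul_ray_ne_zero d hr),
    fun d hd => integrableOn_integral_evenIntegrand s t ξ η hξ.le hd, fun d hd r hr => ?_,
    fun d hd => ?_, ?_⟩
  · simp_rw [hardIntegrandNeg_eq hL hL4 s t hξ.le hη.le, ← mul_assoc, ← Complex.ofReal_mul]
    exact (((integrable_evenIntegrand s t ξ η hξ.le (ofReal_mul_ray_sq_re (hsub hd) (L * r))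
      (ofReal_mul_ray_ne_zero d (mul_pos hL hr))).comp_mul_left' hL.ne').const_mul _).integrableOn
  · have h := (integrableOn_Ioi_comp_mul_left_iff _ 0 hL).mpr (by
      rw [mul_zero]
      exact integrableOn_integral_evenIntegrand s t ξ η hξ.le (hsub hd))
    refine IntegrableOn.congr_fun (h.const_mul (1 / 2 : ℂ)) (fun r hr => ?_) measurableSet_Ioi
    rw [integral_Ioi_hardIntegrandNeg hL hL4 s t hξ.le hη.le (ofReal_mul_ray_sq_re (hsub hd) r)
      (ofReal_mul_ray_ne_zero d hr)]
    push_cast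
    simp only [mul_assoc]
  · have hodd (z : ℂ) : ∫ w : ℝ, evenIntegrand s t ξ η (-z) w =
        -∫ w : ℝ, evenIntegrand s t ξ η z w := by
      simp_rw [evenIntegrand_neg_left, integral_neg]
    have hK : KtildeEven s t ξ η = ((η / Real.sqrt 2 : ℝ) : ℂ) *
        KtildeHardNeg (s / Real.sqrt 2) (t / Real.sqrt 2)
          ((2 : ℝ) ^ (-(3 : ℝ) / 2) * ξ ^ 2) ((2 : ℝ) ^ (-(3 : ℝ) / 2) * η ^ 2) := by
      have hL0 : (L : ℂ) ≠ 0 := Complex.ofReal_ne_zero.mpr hL.ne'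
      have hη0 : (η : ℂ) ≠ 0 := Complex.ofReal_ne_zero.mpr hη.ne'
      have hπ : (Real.pi : ℂ) ≠ 0 := Complex.ofReal_ne_zero.mpr Real.pi_ne_zero
      rw [KtildeEven, KtildeHardNeg, intC_hardIntegrandNeg hL hL4 s t hξ.le hη.le,
        intX_eq_two_mul_intC hodd, sqrt_two_rpow_mul_sq hL hL4 hη.le, sqrt_two_eq_sq hL4]
      push_cast
      field_simp
    have hif : s / Real.sqrt 2 < t / Real.sqrt 2 ↔ s < t :=
      div_lt_div_iff_of_pos_right (by positivity)
    rw [KPearceyEven, KHardNeg, hK, mul_sub]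
    congr 1
    by_cases hst : s < t
    · rw [if_pos hst, if_pos (hif.mpr hst), phiP_add_phiP_neg hL hL4 hst hξ.le hη,
        Complex.ofReal_mul]
    · rw [if_neg hst, if_neg (mt hif.mp hst), mul_zero]
end
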